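/- Let n ≥ 1, let A and B be nonempty subsets of ℝⁿ with infDist-separation dist(A,B) := inf{‖a − b‖ : a ∈ A, b ∈ B} strictly greater than δ > 0, and let λ > 0 satisfy δ < 1/λ. Then there exists a C^∞ function h : ℝⁿ → ℝ such that λ ≤ h(x) ≤ λ/(1 − δ·λ) for all x ∈ ℝⁿ, h equals λ on an open neighborhood of A, h equals λ/(1 − δ·λ) on an open neighborhood of B, and the Fréchet derivative satisfies ‖fderiv h x‖ ≤ h(x)² for every x ∈ ℝⁿ. -/

import Mathlib

open MeasureTheory Metric Set

open scoped ContDiff NNReal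

/-- A Lipschitz map on a finite-dimensional space can be approximated by smooth maps with the same
Lipschitz constant, such that the value of the approximation at `a` stays within any closed ball
containing the values of the original map on the `ε`-ball around `a`. -/
theorem LipschitzWith.exists_contDiff_lipschitzWith {E F : Type*} [NormedAddCommGroup E]
    [NormedSpace ℝ E] [FiniteDimensional ℝ E] [NormedAddCommGroup F] [NormedSpace ℝ F]
    [CompleteSpace F] {f : E → F} {K : ℝ≥0} (hf : LipschitzWith K f) {ε : ℝ} (hε : 0 < ε) :
    ∃ g : E → F, ContDiff ℝ ∞ g ∧ LipschitzWith K g ∧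
      ∀ a z r, 0 ≤ r → (∀ x ∈ ball a ε, dist (f x) z ≤ r) → dist (g a) z ≤ r := by
  borelize E
  let μ : Measure E := Measure.addHaar
  let φ : ContDiffBump (0 : E) := ⟨ε / 2, ε, half_pos hε, half_lt_self hε⟩
  have hloc : LocallyIntegrable f μ := hf.continuous.locallyIntegrable
  refine ⟨convolution (φ.normed μ) f (.lsmul ℝ ℝ) μ,
    φ.hasCompactSupport_normed.contDiff_convolution_left _ φ.contDiff_normed hloc,
    LipschitzWith.of_dist_le_mul fun x y ↦ ?_, fun a z r hr h ↦
    dist_convolution_le hr φ.support_normed_eq.subset φ.nonneg_normed φ.integral_normed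
      hf.continuous.aestronglyMeasurable h⟩
  have hint : ConvolutionExists (φ.normed μ) f (.lsmul ℝ ℝ) μ :=
    φ.hasCompactSupport_normed.convolutionExists_left _ φ.continuous_normed hloc
  rw [dist_eq_norm, convolution_def, convolution_def, ← integral_sub (hint x) (hint y)]
  calc
    _ ≤ ∫ t, φ.normed μ t * (K * dist x y) ∂μ := by
      refine norm_integral_le_of_norm_le (φ.integrable_normed.mul_const _) (.of_forall fun t ↦ ?_)
      rw [ContinuousLinearMap.lsmul_apply, ContinuousLinearMap.lsmul_apply, ← smul_sub, norm_smul,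
        Real.norm_of_nonneg (φ.nonneg_normed t), ← dist_eq_norm]
      refine mul_le_mul_of_nonneg_left ?_ (φ.nonneg_normed t)
      simpa using hf.dist_le_mul (x - t) (y - t)
    _ = K * dist x y := by rw [integral_mul_const, φ.integral_normed, one_mul]

/-- A smooth `1`-Lipschitz function with values in `[0, δ]` that vanishes near `A` and equals `δ`
near `B`, provided that the distance between `A` and `B` is greater than `δ`. -/
theorem exists_contDiff_lipschitzWith_one_separating {E : Type*} [NormedAddCommGroup E]
    [NormedSpace ℝ E] [FiniteDimensional ℝ E] {A B : Set E} (hA : A.Nonempty) {δ : ℝ} (hδ : 0 ≤ δ)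
    (hsep : δ < sInf (image2 dist A B)) :
    ∃ u : E → ℝ, ContDiff ℝ ∞ u ∧ LipschitzWith 1 u ∧ (∀ x, u x ∈ Icc 0 δ) ∧
      (∃ U, IsOpen U ∧ A ⊆ U ∧ ∀ x ∈ U, u x = 0) ∧
      ∃ V, IsOpen V ∧ B ⊆ V ∧ ∀ x ∈ V, u x = δ := by
  obtain ⟨ρ, hρ, hsepρ⟩ : ∃ ρ > 0, δ + 4 * ρ < sInf (image2 dist A B) :=
    ⟨(sInf (image2 dist A B) - δ) / 5, by linarith, by linarith⟩
  have hB : ∀ b ∈ B, δ + 4 * ρ < infDist b A := fun b hb ↦ by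
    refine hsepρ.trans_le ((le_infDist hA).2 fun a ha ↦ ?_)
    rw [dist_comm]
    exact csInf_le ⟨0, by rintro _ ⟨_, _, _, _, rfl⟩; exact dist_nonneg⟩ (mem_image2_of_mem ha hb)
  have hcont : Continuous fun x ↦ infDist x A := continuous_infDist_pt A
  let f : E → ℝ := fun x ↦ max 0 (min δ (infDist x A - 2 * ρ))
  have hf : LipschitzWith 1 f := by
    refine LipschitzWith.const_max (LipschitzWith.const_min (.of_le_add fun x y ↦ ?_) δ) 0
    linarith [infDist_le_infDist_add_dist (s := A) (x := x) (y := y)]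
  obtain ⟨u, hu, hul, hclose⟩ := hf.exists_contDiff_lipschitzWith hρ
  have heq : ∀ a z, (∀ x ∈ ball a ρ, f x = z) → u a = z := fun a z h ↦
    dist_le_zero.1 (hclose a z 0 le_rfl fun x hx ↦ (dist_eq_zero.2 (h x hx)).le)
  refine ⟨u, hu, hul, fun x ↦ ?_, ⟨{x | infDist x A < ρ}, isOpen_lt hcont continuous_const,
    fun a ha ↦ ?_, fun x hx ↦ heq x 0 fun y hy ↦ ?_⟩, {x | δ + 3 * ρ < infDist x A},
    isOpen_lt continuous_const hcont, fun b hb ↦ ?_, fun x hx ↦ heq x δ fun y hy ↦ ?_⟩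
  · have h := hclose x (δ / 2) (δ / 2) (by positivity) fun y _ ↦ by
      have h0 : 0 ≤ f y := le_max_left _ _
      have h1 : f y ≤ δ := max_le hδ (min_le_left _ _)
      rw [Real.dist_eq, abs_le]
      constructor <;> linarith
    rw [Real.dist_eq, abs_le] at h
    constructor <;> linarith
  · simpa [infDist_zero_of_mem ha] using hρ
  · have h : infDist x A < ρ := hx
    have := infDist_le_infDist_add_dist (s := A) (x := y) (y := x)
    rw [mem_ball] at hy
    exact max_eq_left ((min_le_right _ _).trans (by linarith))
  · have := hB b hb
    rw [mem_ofPred_eq]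
    linarith
  · have h : δ + 3 * ρ < infDist x A := hx
    have := infDist_le_infDist_add_dist (s := A) (x := x) (y := y)
    rw [mem_ball'] at hy
    simp only [f]
    rw [min_eq_left (by linarith), max_eq_right hδ]


/-- Euclidean version of Lemma 3.3: if `A, B ⊆ ℝⁿ` are nonempty with
separation `inf{‖a − b‖} > δ > 0` and `λ > 0` satisfies `δ < 1/λ`,
then there is a smooth `h : ℝⁿ → ℝ` with values in `[λ, λ/(1 − δλ)]`,
equal to `λ` near `A`, equal to `λ/(1 − δλ)` near `B`, and with
`‖dh‖ ≤ h²` everywhere. -/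
theorem escape_to_infinity_euclidean (n : ℕ) (hn : 1 ≤ n)
    (A B : Set (EuclideanSpace ℝ (Fin n))) (hA : A.Nonempty) (hB : B.Nonempty)
    (δ lam : ℝ) (hδ : 0 < δ) (hlam : 0 < lam) (hδlam : δ < 1 / lam)
    (hsep : δ < sInf (Set.image2 dist A B)) :
    ∃ h : EuclideanSpace ℝ (Fin n) → ℝ, ContDiff ℝ (⊤ : ℕ∞) h ∧
      (∀ x, lam ≤ h x ∧ h x ≤ lam / (1 - δ * lam)) ∧
      (∃ U : Set (EuclideanSpace ℝ (Fin n)), IsOpen U ∧ A ⊆ U ∧ ∀ x ∈ U, h x = lam) ∧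
      (∃ V : Set (EuclideanSpace ℝ (Fin n)), IsOpen V ∧ B ⊆ V ∧
        ∀ x ∈ V, h x = lam / (1 - δ * lam)) ∧
      (∀ x, ‖fderiv ℝ h x‖ ≤ (h x) ^ 2) := by
  obtain ⟨u, hu, hul, hmem, ⟨U, hU, hAU, huU⟩, V, hV, hBV, huV⟩ :=
    exists_contDiff_lipschitzWith_one_separating hA hδ.le hsep
  have hδ1 : 0 < 1 - δ * lam := by
    rw [lt_div_iff₀ hlam] at hδlam
    linarith
  have hden : ∀ x, 1 - δ * lam ≤ 1 - u x * lam := fun x ↦ by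
    have := (hmem x).2
    gcongr
  have hpos : ∀ x, 0 < 1 - u x * lam := fun x ↦ hδ1.trans_le (hden x)
  refine ⟨fun x ↦ lam / (1 - u x * lam), ?_, fun x ↦ ⟨?_, ?_⟩, ⟨U, hU, hAU, fun x hx ↦ ?_⟩,
    ⟨V, hV, hBV, fun x hx ↦ ?_⟩, fun x ↦ ?_⟩
  · exact contDiff_const.div (contDiff_const.sub (hu.mul contDiff_const)) fun x ↦ (hpos x).ne'
  · refine le_div_self hlam.le (hpos x) ?_
    linarith [mul_nonneg (hmem x).1 hlam.le]
  · exact div_le_div_of_nonneg_left hlam.le hδ1 (hden x)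
  · simp [huU x hx]
  · simp [huV x hx]
  · have hφ : HasDerivAt (fun t : ℝ ↦ lam / (1 - t * lam)) ((lam / (1 - u x * lam)) ^ 2) (u x) := by
      have h := (hasDerivAt_const (u x) lam).div
        (((hasDerivAt_id (u x)).mul_const lam).const_sub 1) (hpos x).ne'
      refine h.congr_deriv ?_
      simp only [id]
      rw [div_pow]
      ring
    have hux : HasFDerivAt u (fderiv ℝ u x) x :=
      (hu.differentiable (by simp) x).hasFDerivAt
    have h := (hφ.comp_hasFDerivAt x hux).fderiv
    have h1 : ‖fderiv ℝ u x‖ ≤ 1 := norm_fderiv_le_of_lipschitz ℝ hul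
    change ‖fderiv ℝ ((fun t : ℝ ↦ lam / (1 - t * lam)) ∘ u) x‖ ≤ _
    rw [h, norm_smul, Real.norm_of_nonneg (sq_nonneg _)]
    exact mul_le_of_le_one_right (sq_nonneg _) h1
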